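/- Let ρ₀ ∈ [0, 1), β > 0, γ > 0, σ > 0, μ > 0, and define ρ(P) = ρ₀ + β(P − 1)^γ, g(P) = (1 − ρ(P))/P + ρ(P), and the Cantelli hallucination bound ℬ(P) = σ²g(P)/(σ²g(P) + μ²) for real P > 1, assuming σ²g(P) + μ² > 0 throughout. Then: (i) there exists δ > 0 such that ℬ is strictly decreasing on (1, 1 + δ); (ii) there exists P₀ > 1 such that ℬ is strictly increasing on [P₀, ∞); and (iii) if moreover γ ≥ 1, there exists a unique minimizer P⋆ ∈ (1, ∞) of ℬ on (1, ∞), with ℬ strictly decreasing on (1, P⋆] and strictly increasing on [P⋆, ∞). -/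

import Mathlib

/-- Rising correlation model: ρ(P) = ρ₀ + β(P − 1)^γ (real exponent). -/
noncomputable def rhoFun (ρ₀ β γ P : ℝ) : ℝ := ρ₀ + β * (P - 1) ^ γ

/-- Unnormalized variance factor: g(P) = (1 − ρ(P))/P + ρ(P). -/
noncomputable def gFun (ρ₀ β γ P : ℝ) : ℝ :=
  (1 - rhoFun ρ₀ β γ P) / P + rhoFun ρ₀ β γ P

/-- Cantelli hallucination bound: ℬ(P) = σ²g(P)/(σ²g(P) + μ²). -/
noncomputable def cantelliBound (ρ₀ β γ σ μ P : ℝ) : ℝ :=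
  σ ^ 2 * gFun ρ₀ β γ P / (σ ^ 2 * gFun ρ₀ β γ P + μ ^ 2)

/-- The numerator of the derivative of `gFun` at `1 + x`. -/
noncomputable def gSlope (ρ₀ β γ x : ℝ) : ℝ :=
  ρ₀ - 1 + β * (γ + 1) * x ^ γ + β * γ * (x ^ γ * x)

lemma hasDerivAt_gFun (ρ₀ β γ : ℝ) {P : ℝ} (hP : 1 < P) :
    HasDerivAt (gFun ρ₀ β γ) (gSlope ρ₀ β γ (P - 1) / P ^ 2) P := by
  have hx : 0 < P - 1 := sub_pos.2 hP
  have hP0 : P ≠ 0 := by positivity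
  have hρ : HasDerivAt (rhoFun ρ₀ β γ) (β * (1 * γ * (P - 1) ^ (γ - 1))) P :=
    ((((hasDerivAt_id P).sub_const 1).rpow_const (Or.inl hx.ne')).const_mul β).const_add ρ₀
  have hg := ((hρ.const_sub 1).div (hasDerivAt_id P) hP0).add hρ
  refine hg.congr_deriv ?_
  have hpow : (P - 1) ^ γ = (P - 1) ^ (γ - 1) * (P - 1) := by
    rw [← Real.rpow_add_one hx.ne', sub_add_cancel]
  simp only [gSlope, rhoFun, id, hpow]
  field_simp
  ring

lemma gSlope_strictMonoOn (ρ₀ : ℝ) {β γ : ℝ} (hβ : 0 < β) (hγ : 0 < γ) :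
    StrictMonoOn (gSlope ρ₀ β γ) (Set.Ici 0) := by
  intro x hx y hy hxy
  have hx : 0 ≤ x := hx
  have hpow : x ^ γ < y ^ γ := Real.rpow_lt_rpow hx hxy hγ
  have hpow' : x ^ γ * x ≤ y ^ γ * y :=
    mul_le_mul hpow.le hxy.le hx (Real.rpow_nonneg hy γ)
  unfold gSlope
  gcongr

lemma exists_gSlope_eq_zero {ρ₀ β γ : ℝ} (hρ₀ : ρ₀ < 1) (hβ : 0 < β) (hγ : 0 < γ) :
    ∃ x, 0 < x ∧ gSlope ρ₀ β γ x = 0 := by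
  have hzero : gSlope ρ₀ β γ 0 < 0 := by
    simp [gSlope, Real.zero_rpow hγ.ne', hρ₀]
  obtain ⟨X, hX, hX0⟩ :=
    (((tendsto_rpow_atTop hγ).eventually_ge_atTop ((1 - ρ₀) / (β * (γ + 1)))).and
      (Filter.eventually_ge_atTop (0 : ℝ))).exists
  have hXpos : 0 ≤ gSlope ρ₀ β γ X := by
    rw [div_le_iff₀ (by positivity)] at hX
    have : 0 ≤ β * γ * (X ^ γ * X) := by positivity
    unfold gSlope
    linarith
  have hcont : Continuous (gSlope ρ₀ β γ) := by
    have := Real.continuous_rpow_const hγ.le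
    unfold gSlope
    fun_prop
  obtain ⟨x, hx, hx0⟩ := intermediate_value_Icc hX0 hcont.continuousOn ⟨hzero.le, hXpos⟩
  refine ⟨x, hx.1.lt_of_ne ?_, hx0⟩
  rintro rfl
  exact hzero.ne hx0

/-- `gFun` is U-shaped on `(1, ∞)` for every `γ > 0`. -/
lemma exists_strictAntiOn_strictMonoOn_gFun {ρ₀ β γ : ℝ} (hρ₀ : ρ₀ < 1) (hβ : 0 < β)
    (hγ : 0 < γ) :
    ∃ P, 1 < P ∧ StrictAntiOn (gFun ρ₀ β γ) (Set.Ioc 1 P) ∧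
      StrictMonoOn (gFun ρ₀ β γ) (Set.Ici P) := by
  obtain ⟨x, hx, hx0⟩ := exists_gSlope_eq_zero hρ₀ hβ hγ
  have hmono := gSlope_strictMonoOn ρ₀ hβ hγ
  refine ⟨1 + x, by linarith, ?_, ?_⟩
  · refine strictAntiOn_of_deriv_neg (convex_Ioc _ _)
      (fun P hP ↦ (hasDerivAt_gFun ρ₀ β γ hP.1).continuousAt.continuousWithinAt) ?_
    intro P hP
    rw [interior_Ioc] at hP
    have hP1 : 1 < P := hP.1
    rw [(hasDerivAt_gFun ρ₀ β γ hP1).deriv]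
    refine div_neg_of_neg_of_pos ?_ (by positivity)
    rw [← hx0]
    exact hmono (sub_nonneg.2 hP1.le) hx.le (by linarith [hP.2])
  · have hlt : ∀ P ∈ Set.Ici (1 + x), 1 < P := fun P hP ↦ by
      linarith [Set.mem_Ici.1 hP]
    refine strictMonoOn_of_deriv_pos (convex_Ici _)
      (fun P hP ↦ (hasDerivAt_gFun ρ₀ β γ (hlt P hP)).continuousAt.continuousWithinAt) ?_
    intro P hP
    have hP1 : 1 < P := hlt P (interior_subset hP)
    rw [interior_Ici] at hP
    rw [(hasDerivAt_gFun ρ₀ β γ hP1).deriv]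
    refine div_pos ?_ (by positivity)
    rw [← hx0]
    exact hmono hx.le (sub_nonneg.2 hP1.le) (by linarith [Set.mem_Ioi.1 hP])

lemma strictMonoOn_mul_div_mul_add {a b : ℝ} (ha : 0 < a) (hb : 0 < b) :
    StrictMonoOn (fun x : ℝ ↦ a * x / (a * x + b)) {x | 0 < a * x + b} := by
  intro x hx y hy hxy
  refine (div_lt_div_iff₀ hx hy).2 ?_
  nlinarith [mul_pos (mul_pos ha hb) (sub_pos.2 hxy)]

/-- The point where a function on `(a, ∞)` switches from strictly decreasing to strictly
increasing is unique. -/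
lemma eq_of_strictAntiOn_Ioc_of_strictMonoOn_Ici {f : ℝ → ℝ} {a p q : ℝ} (hp : a < p)
    (hq : a < q) (hpa : StrictAntiOn f (Set.Ioc a p)) (hpm : StrictMonoOn f (Set.Ici p))
    (hqa : StrictAntiOn f (Set.Ioc a q)) (hqm : StrictMonoOn f (Set.Ici q)) : q = p := by
  rcases lt_trichotomy q p with h | h | h
  · exact absurd (hpa ⟨hq, h.le⟩ ⟨hp, le_rfl⟩ h) (hqm Set.self_mem_Ici h.le h).not_gt
  · exact h
  · exact absurd (hqa ⟨hp, h.le⟩ ⟨hq, le_rfl⟩ h) (hpm Set.self_mem_Ici h.le h).not_gt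

/-- **U-shape of the hallucination bound under rising correlation:**
(i) ℬ is strictly decreasing just right of 1; (ii) ℬ is strictly increasing on some
[P₀, ∞); (iii) if γ ≥ 1, ℬ has a unique minimizer P⋆ on (1, ∞), being strictly
decreasing on (1, P⋆] and strictly increasing on [P⋆, ∞). -/
theorem cantelliBound_U_shape (ρ₀ β γ σ μ : ℝ) (hρ₀ : ρ₀ ∈ Set.Ico (0 : ℝ) 1)
    (hβ : 0 < β) (hγ : 0 < γ) (hσ : 0 < σ) (hμ : 0 < μ)
    (hpos : ∀ P : ℝ, 1 < P → 0 < σ ^ 2 * gFun ρ₀ β γ P + μ ^ 2) :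
    (∃ δ > (0 : ℝ), StrictAntiOn (cantelliBound ρ₀ β γ σ μ) (Set.Ioo (1 : ℝ) (1 + δ))) ∧
    (∃ P₀ : ℝ, 1 < P₀ ∧ StrictMonoOn (cantelliBound ρ₀ β γ σ μ) (Set.Ici P₀)) ∧
    (1 ≤ γ →
      ∃ Pstar : ℝ, 1 < Pstar ∧
        StrictAntiOn (cantelliBound ρ₀ β γ σ μ) (Set.Ioc (1 : ℝ) Pstar) ∧
        StrictMonoOn (cantelliBound ρ₀ β γ σ μ) (Set.Ici Pstar) ∧
        (∀ Q : ℝ, 1 < Q →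
          StrictAntiOn (cantelliBound ρ₀ β γ σ μ) (Set.Ioc (1 : ℝ) Q) →
          StrictMonoOn (cantelliBound ρ₀ β γ σ μ) (Set.Ici Q) → Q = Pstar) ∧
        (∀ P : ℝ, 1 < P → P ≠ Pstar →
          cantelliBound ρ₀ β γ σ μ Pstar < cantelliBound ρ₀ β γ σ μ P)) := by
  obtain ⟨p, hp, hganti, hgmono⟩ := exists_strictAntiOn_strictMonoOn_gFun hρ₀.2 hβ hγ
  have hφ := strictMonoOn_mul_div_mul_add (pow_pos hσ 2) (pow_pos hμ 2)
  have hanti : StrictAntiOn (cantelliBound ρ₀ β γ σ μ) (Set.Ioc 1 p) :=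
    hφ.comp_strictAntiOn hganti fun P hP ↦ hpos P hP.1
  have hmono : StrictMonoOn (cantelliBound ρ₀ β γ σ μ) (Set.Ici p) :=
    hφ.comp hgmono fun P hP ↦ hpos P (hp.trans_le hP)
  refine ⟨⟨p - 1, sub_pos.2 hp, hanti.mono ?_⟩, ⟨p, hp, hmono⟩,
    fun _ ↦ ⟨p, hp, hanti, hmono, ?_, ?_⟩⟩
  · rw [add_sub_cancel]
    exact Set.Ioo_subset_Ioc_self
  · exact fun Q hQ hQa hQm ↦
      eq_of_strictAntiOn_Ioc_of_strictMonoOn_Ici hp hQ hanti hmono hQa hQm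
  · intro P hP hne
    rcases hne.lt_or_gt with h | h
    · exact hanti ⟨hP, h.le⟩ ⟨hp, le_rfl⟩ h
    · exact hmono Set.self_mem_Ici h.le h
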